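/- Let γ : ℝ → ℝ be measurable with γ(ξ) > 0 for all ξ, and suppose there is a constant C > 0 such that √(γ(ξ)) ≤ C (√(γ(ξ − η)) + √(γ(η))) for all ξ, η ∈ ℝ. Then there is a constant C' > 0, depending only on C, such that for all Schwartz functions u, v : ℝ → ℂ, |uv|_γ ≤ C' ( |u|_γ ‖v̂‖_{L¹(ℝ)} + |v|_γ ‖û‖_{L¹(ℝ)} ). -/

import Mathlib

open MeasureTheory

/-- Fourier transform with the convention `û(ξ) = ∫ u(x) e^{-iξx} dx`. -/
noncomputable def FT (u : ℝ → ℂ) (ξ : ℝ) : ℂ :=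
  ∫ x : ℝ, u x * Complex.exp (-(Complex.I * (ξ : ℂ) * (x : ℂ)))

open scoped ENNReal FourierTransform

/-- Steinhaus-type argument: a measurable quasi-subadditive function is bounded near the origin. -/
lemma exists_forall_abs_le_one_le {g : ℝ → ℝ} (hg : Measurable g) {C : ℝ} (hC : 0 < C)
    (hsub : ∀ x y, g x ≤ C * (g (x - y) + g y)) :
    ∃ K : ℝ, ∀ x, |x| ≤ 1 → g x ≤ K := by
  set S : ℕ → Set ℝ := fun n => Set.Icc (-1) 1 ∩ {y | (n : ℝ) < g y} with hS
  have hSm : ∀ n, MeasurableSet (S n) := fun n =>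
    measurableSet_Icc.inter (measurableSet_lt measurable_const hg)
  have hanti : Antitone S := fun m n hmn x hx =>
    ⟨hx.1, lt_of_le_of_lt (Nat.cast_le.mpr hmn : (m : ℝ) ≤ n) hx.2⟩
  have hempty : ⋂ n, S n = ∅ := by
    ext x
    simp only [Set.mem_iInter, Set.mem_empty_iff_false, iff_false, not_forall]
    obtain ⟨n, hn⟩ := exists_nat_ge (g x)
    exact ⟨n, fun h => absurd h.2 (not_lt.mpr hn)⟩
  have hlim := tendsto_measure_iInter_atTop (μ := (volume : Measure ℝ))
    (fun n => (hSm n).nullMeasurableSet) hanti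
    ⟨0, measure_ne_top_of_subset Set.inter_subset_left (by simp)⟩
  rw [hempty, measure_empty] at hlim
  obtain ⟨n, hn⟩ := (hlim.eventually_lt_const (show (0 : ℝ≥0∞) < 1 / 2 by simp)).exists
  refine ⟨C * (n + n), fun x hx => ?_⟩
  by_contra! hlt
  have hx' := abs_le.mp hx
  have hcover : Set.Icc (x / 2 - 1 / 2) (x / 2 + 1 / 2) ⊆ S n ∪ (fun y => x - y) ⁻¹' S n := by
    intro y hy
    by_cases h1 : (n : ℝ) < g y
    · exact Or.inl ⟨⟨by linarith [hy.1], by linarith [hy.2]⟩, h1⟩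
    · refine Or.inr ⟨⟨by linarith [hy.2], by linarith [hy.1]⟩, ?_⟩
      by_contra h2
      have h2' : g (x - y) ≤ n := not_lt.mp h2
      have := hsub x y
      nlinarith [not_lt.mp h1]
  have hle := (measure_mono (μ := (volume : Measure ℝ)) hcover).trans (measure_union_le _ _)
  rw [Real.volume_Icc, (Measure.measurePreserving_sub_left volume x).measure_preimage
    (hSm n).nullMeasurableSet] at hle
  have h1 : x / 2 + 1 / 2 - (x / 2 - 1 / 2) = 1 := by ring
  rw [h1, ENNReal.ofReal_one] at hle
  have h2 := ENNReal.add_lt_add hn hn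
  rw [ENNReal.add_halves] at h2
  exact absurd hle (not_le.mpr h2)

/-- A positive measurable quasi-subadditive function grows at most polynomially. -/
lemma exists_le_mul_one_add_abs_pow {g : ℝ → ℝ} (hg : Measurable g) (hg0 : ∀ x, 0 < g x)
    {C : ℝ} (hC : 0 < C) (hsub : ∀ x y, g x ≤ C * (g (x - y) + g y)) :
    ∃ (K : ℝ) (p : ℕ), 0 ≤ K ∧ ∀ x, g x ≤ K * (1 + |x|) ^ p := by
  obtain ⟨K, hK⟩ := exists_forall_abs_le_one_le hg hC hsub
  have hK0 : 0 ≤ K := (hg0 0).le.trans (hK 0 (by simp))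
  have hdouble : ∀ x, g x ≤ 2 * C * g (x / 2) := fun x => by
    have := hsub x (x / 2)
    rw [sub_half] at this
    linarith
  have hiter : ∀ (n : ℕ) (x : ℝ), |x| ≤ 2 ^ n → g x ≤ K * (2 * C) ^ n := by
    intro n
    induction n with
    | zero => intro x hx; simpa using hK x (by simpa using hx)
    | succ n ih =>
      intro x hx
      have hx2 : |x / 2| ≤ 2 ^ n := by
        rw [abs_div, abs_two, div_le_iff₀ two_pos, ← pow_succ]
        exact hx
      calc g x ≤ 2 * C * g (x / 2) := hdouble x
        _ ≤ 2 * C * (K * (2 * C) ^ n) := by gcongr; exact ih _ hx2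
        _ = K * (2 * C) ^ (n + 1) := by ring
  obtain ⟨p, hp⟩ := pow_unbounded_of_one_lt (2 * C) (one_lt_two (α := ℝ))
  refine ⟨K * 2 ^ p, p, by positivity, fun x => ?_⟩
  obtain ⟨n, hn1, hn2⟩ := exists_nat_pow_near (show (1 : ℝ) ≤ 1 + |x| by simp) one_lt_two
  calc g x ≤ K * (2 * C) ^ (n + 1) := hiter _ x (by linarith)
    _ ≤ K * (2 ^ p) ^ (n + 1) := by gcongr
    _ = K * 2 ^ p * (2 ^ n) ^ p := by ring
    _ ≤ K * 2 ^ p * (1 + |x|) ^ p := by gcongr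

lemma FT_eq_fourier (u : ℝ → ℂ) (ξ : ℝ) : FT u ξ = 𝓕 u ((2 * Real.pi)⁻¹ * ξ) := by
  rw [FT, Real.fourier_eq']
  congr 1
  ext x
  rw [smul_eq_mul, mul_comm]
  congr 2
  have hpi : (Real.pi : ℂ) ≠ 0 := by exact_mod_cast Real.pi_ne_zero
  simp only [RCLike.inner_apply, conj_trivial]
  push_cast
  field_simp

lemma continuous_FT (u : SchwartzMap ℝ ℂ) : Continuous (FT u) := by
  have h : FT u = fun ξ => (𝓕 u : SchwartzMap ℝ ℂ) ((2 * Real.pi)⁻¹ * ξ) := by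
    ext ξ
    rw [FT_eq_fourier, SchwartzMap.fourier_coe]
  rw [h]
  exact (SchwartzMap.continuous _).comp (by fun_prop)

lemma exists_one_add_abs_pow_mul_norm_FT_le (u : SchwartzMap ℝ ℂ) (k : ℕ) :
    ∃ M : ℝ, 0 ≤ M ∧ ∀ ξ, (1 + |ξ|) ^ k * ‖FT u ξ‖ ≤ M := by
  set M := 2 ^ k * ((Finset.Iic (k, 0)).sup fun m => SchwartzMap.seminorm ℂ m.1 m.2)
    (𝓕 u : SchwartzMap ℝ ℂ) with hM
  have hbound : ∀ x, (1 + |x|) ^ k * ‖(𝓕 u : SchwartzMap ℝ ℂ) x‖ ≤ M := fun x => by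
    simpa using SchwartzMap.one_add_le_sup_seminorm_apply (𝕜 := ℂ) (m := (k, 0)) le_rfl le_rfl
      (𝓕 u : SchwartzMap ℝ ℂ) x
  have hM0 : 0 ≤ M := le_trans (by positivity) (hbound 0)
  refine ⟨(2 * Real.pi) ^ k * M, by positivity, fun ξ => ?_⟩
  have hpi : 1 ≤ 2 * Real.pi := by linarith [Real.pi_gt_three]
  have h1 : 1 + |ξ| ≤ 2 * Real.pi * (1 + |(2 * Real.pi)⁻¹ * ξ|) := by
    rw [abs_mul, abs_of_pos (show 0 < (2 * Real.pi)⁻¹ by positivity), mul_add,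
      mul_inv_cancel_left₀ (by positivity)]
    linarith
  rw [FT_eq_fourier, ← SchwartzMap.fourier_coe]
  calc (1 + |ξ|) ^ k * ‖(𝓕 u : SchwartzMap ℝ ℂ) ((2 * Real.pi)⁻¹ * ξ)‖
      ≤ (2 * Real.pi * (1 + |(2 * Real.pi)⁻¹ * ξ|)) ^ k *
        ‖(𝓕 u : SchwartzMap ℝ ℂ) ((2 * Real.pi)⁻¹ * ξ)‖ := by gcongr
    _ = (2 * Real.pi) ^ k * ((1 + |(2 * Real.pi)⁻¹ * ξ|) ^ k *
        ‖(𝓕 u : SchwartzMap ℝ ℂ) ((2 * Real.pi)⁻¹ * ξ)‖) := by rw [mul_pow, mul_assoc]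
    _ ≤ _ := by gcongr; exact hbound _

lemma integrable_one_add_abs_pow_neg_two : Integrable fun x : ℝ => ((1 + |x|) ^ 2)⁻¹ := by
  have h := integrable_one_add_norm (E := ℝ) (μ := volume) (r := 2) (by simp)
  refine h.congr (Filter.Eventually.of_forall fun x => ?_)
  have h0 : 0 ≤ 1 + ‖x‖ := by positivity
  beta_reduce
  rw [Real.rpow_neg h0, Real.norm_eq_abs, Real.rpow_two]

lemma integrable_FT (u : SchwartzMap ℝ ℂ) : Integrable (FT u) := by
  obtain ⟨M, -, hM⟩ := exists_one_add_abs_pow_mul_norm_FT_le u 2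
  refine (integrable_one_add_abs_pow_neg_two.const_mul M).mono'
    (continuous_FT u).aestronglyMeasurable (Filter.Eventually.of_forall fun x => ?_)
  rw [← div_eq_mul_inv, le_div_iff₀ (by positivity), mul_comm]
  exact hM x

/-- The weighted seminorm of a Schwartz function is finite when the weight grows polynomially. -/
lemma integrable_mul_norm_FT_sq {γ : ℝ → ℝ} (hγ : Measurable γ) (hγ0 : ∀ ξ, 0 < γ ξ) {K : ℝ}
    {p : ℕ} (hK : 0 ≤ K) (hbound : ∀ ξ, Real.sqrt (γ ξ) ≤ K * (1 + |ξ|) ^ p)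
    (u : SchwartzMap ℝ ℂ) : Integrable fun ξ => γ ξ * ‖FT u ξ‖ ^ 2 := by
  obtain ⟨M, hM0, hM⟩ := exists_one_add_abs_pow_mul_norm_FT_le u (p + 1)
  refine (integrable_one_add_abs_pow_neg_two.const_mul ((K * M) ^ 2)).mono'
    (hγ.mul ((continuous_FT u).norm.measurable.pow_const 2)).aestronglyMeasurable
    (Filter.Eventually.of_forall fun x => ?_)
  rw [Real.norm_of_nonneg (mul_nonneg (hγ0 x).le (by positivity)), ← div_eq_mul_inv,
    le_div_iff₀ (by positivity)]
  calc γ x * ‖FT u x‖ ^ 2 * (1 + |x|) ^ 2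
      = (Real.sqrt (γ x) * ‖FT u x‖ * (1 + |x|)) ^ 2 := by
        rw [mul_pow, mul_pow, Real.sq_sqrt (hγ0 x).le]
    _ ≤ (K * (1 + |x|) ^ p * ‖FT u x‖ * (1 + |x|)) ^ 2 := by gcongr; exact hbound x
    _ = (K * ((1 + |x|) ^ (p + 1) * ‖FT u x‖)) ^ 2 := by ring
    _ ≤ (K * M) ^ 2 := by gcongr; exact hM x

/-- The Fourier transform of a product is the normalized convolution of the transforms. -/
lemma FT_mul (u v : SchwartzMap ℝ ℂ) (ξ : ℝ) :
    FT (fun x => u x * v x) ξ = (2 * Real.pi)⁻¹ * ∫ η, FT u (ξ - η) * FT v η := by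
  have key : ∀ y : ℝ, 𝓕 (fun x => u x * v x) y = ∫ t, 𝓕 (⇑v) t * 𝓕 (⇑u) (y - t) := by
    intro y
    set U : SchwartzMap ℝ ℂ := 𝓕⁻ u with hU
    set V : SchwartzMap ℝ ℂ := 𝓕⁻ v with hV
    set B := ContinuousLinearMap.mul ℂ ℂ with hB
    have h1 : (fun x => u x * v x) = ⇑(𝓕 (SchwartzMap.convolution B V U) : SchwartzMap ℝ ℂ) := by
      ext x
      rw [SchwartzMap.fourier_convolution, SchwartzMap.pairing_apply_apply]
      simp [hU, hV, hB, mul_comm]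
    have h2 : 𝓕 (fun x => u x * v x) y = SchwartzMap.convolution B V U (-y) := by
      have h3 : 𝓕⁻ (𝓕 (SchwartzMap.convolution B V U)) = SchwartzMap.convolution B V U := by simp
      rw [← h3, SchwartzMap.fourierInv_coe, ← h1, Real.fourierInv_eq_fourier_neg, neg_neg]
    rw [h2, SchwartzMap.convolution_apply, convolution_def, ← integral_neg_eq_self]
    congr 1
    ext t
    rw [hB, ContinuousLinearMap.mul_apply', hU, hV, SchwartzMap.fourierInv_coe,
      SchwartzMap.fourierInv_coe, Real.fourierInv_eq_fourier_neg, Real.fourierInv_eq_fourier_neg]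
    rw [neg_neg, show -(-y - -t) = y - t by ring]
  rw [FT_eq_fourier, key]
  have h := Measure.integral_comp_mul_left
    (fun t => 𝓕 (⇑v) t * 𝓕 (⇑u) ((2 * Real.pi)⁻¹ * ξ - t)) (2 * Real.pi)⁻¹
  simp only [FT_eq_fourier, mul_sub]
  simp only [mul_comm (𝓕 (⇑u) _)]
  rw [h, inv_inv, abs_of_pos (by positivity), Complex.real_smul, ← mul_assoc]
  have hpi : (Real.pi : ℂ) ≠ 0 := by exact_mod_cast Real.pi_ne_zero
  push_cast
  field_simp

/-- Cauchy–Schwarz for a weighted integral. -/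
lemma lintegral_mul_sq_le {α : Type*} [MeasurableSpace α] {μ : Measure α} {f h : α → ℝ≥0∞}
    (hf : Measurable f) (hh : Measurable h) :
    (∫⁻ x, f x * h x ∂μ) ^ 2 ≤ (∫⁻ x, f x ^ 2 * h x ∂μ) * ∫⁻ x, h x ∂μ := by
  have hw : ∀ {k : α → ℝ≥0∞}, Measurable k →
      ∫⁻ x, k x ∂μ.withDensity h = ∫⁻ x, k x * h x ∂μ := fun hk => by
    rw [lintegral_withDensity_eq_lintegral_mul _ hh hk]
    simp [mul_comm]
  have hCS := ENNReal.lintegral_mul_le_Lp_mul_Lq (μ.withDensity h) Real.HolderConjugate.two_two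
    hf.aemeasurable (aemeasurable_const (b := (1 : ℝ≥0∞)))
  have hsq : ∀ a : ℝ≥0∞, (a ^ (1 / 2 : ℝ)) ^ 2 = a := fun a => by
    rw [← ENNReal.rpow_natCast, ← ENNReal.rpow_mul]
    norm_num
  simp only [Pi.mul_apply, mul_one, ENNReal.rpow_two] at hCS
  have h2 := pow_le_pow_left₀ bot_le hCS 2
  rw [mul_pow, hsq, hsq, hw hf, hw (hf.pow_const 2), hw measurable_const] at h2
  simpa using h2

/-- Young's convolution inequality `L² ∗ L¹ ⊆ L²`. -/
lemma lintegral_convolution_sq_le {f h : ℝ → ℝ≥0∞} (hf : Measurable f) (hh : Measurable h) :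
    ∫⁻ ξ, (∫⁻ η, f (ξ - η) * h η) ^ 2 ≤ (∫⁻ ξ, f ξ ^ 2) * (∫⁻ η, h η) ^ 2 := by
  calc ∫⁻ ξ, (∫⁻ η, f (ξ - η) * h η) ^ 2
      ≤ ∫⁻ ξ, (∫⁻ η, f (ξ - η) ^ 2 * h η) * ∫⁻ η, h η := by
        refine lintegral_mono fun ξ => lintegral_mul_sq_le (f := fun η => f (ξ - η)) ?_ hh
        fun_prop
    _ = (∫⁻ ξ, ∫⁻ η, f (ξ - η) ^ 2 * h η) * ∫⁻ η, h η := by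
        refine lintegral_mul_const _ (Measurable.lintegral_prod_right'
          (f := fun z : ℝ × ℝ => f (z.1 - z.2) ^ 2 * h z.2) ?_)
        fun_prop
    _ = (∫⁻ η, ∫⁻ ξ, f (ξ - η) ^ 2 * h η) * ∫⁻ η, h η := by
        rw [lintegral_lintegral_swap]
        refine Measurable.aemeasurable ?_
        unfold Function.uncurry
        fun_prop
    _ = (∫⁻ ξ, f ξ ^ 2) * (∫⁻ η, h η) ^ 2 := by
        have : ∀ η, ∫⁻ ξ, f (ξ - η) ^ 2 * h η = (∫⁻ ξ, f ξ ^ 2) * h η := fun η => by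
          rw [lintegral_mul_const _ (by fun_prop),
            lintegral_sub_right_eq_self (fun ξ => f ξ ^ 2) η]
        simp only [this]
        rw [lintegral_const_mul _ hh, sq, mul_assoc]

/-- If `w` is dominated by `U ∗ V` and the weight `s` is quasi-subadditive, then `s w` is
controlled in `L²`. -/
lemma lintegral_weight_mul_sq_le {s U V w : ℝ → ℝ≥0∞} (hs : Measurable s) (hU : Measurable U)
    (hV : Measurable V) {c k : ℝ≥0∞} (hsub : ∀ ξ η, s ξ ≤ c * (s (ξ - η) + s η))
    (hw : ∀ ξ, w ξ ≤ k * ∫⁻ η, U (ξ - η) * V η) :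
    ∫⁻ ξ, (s ξ * w ξ) ^ 2 ≤ 2 * (k * c) ^ 2 *
      ((∫⁻ ξ, (s ξ * U ξ) ^ 2) * (∫⁻ ξ, V ξ) ^ 2 +
        (∫⁻ ξ, (s ξ * V ξ) ^ 2) * (∫⁻ ξ, U ξ) ^ 2) := by
  set F : ℝ → ℝ≥0∞ := fun ξ => ∫⁻ η, (s (ξ - η) * U (ξ - η)) * V η with hF
  set G : ℝ → ℝ≥0∞ := fun ξ => ∫⁻ η, (s (ξ - η) * V (ξ - η)) * U η with hG
  have hFm : Measurable F := Measurable.lintegral_prod_right'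
    (f := fun z : ℝ × ℝ => (s (z.1 - z.2) * U (z.1 - z.2)) * V z.2) (by fun_prop)
  have hGm : Measurable G := Measurable.lintegral_prod_right'
    (f := fun z : ℝ × ℝ => (s (z.1 - z.2) * V (z.1 - z.2)) * U z.2) (by fun_prop)
  have hpt : ∀ ξ, s ξ * w ξ ≤ k * c * (F ξ + G ξ) := fun ξ => by
    have hGξ : G ξ = ∫⁻ η, U (ξ - η) * (s η * V η) := by
      rw [← lintegral_sub_left_eq_self _ ξ]
      simp [hG, mul_comm]
    calc s ξ * w ξ ≤ s ξ * (k * ∫⁻ η, U (ξ - η) * V η) := by gcongr; exact hw ξ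
      _ = k * ∫⁻ η, s ξ * (U (ξ - η) * V η) := by
        rw [lintegral_const_mul _ (by fun_prop), mul_left_comm]
      _ ≤ k * ∫⁻ η, c * (s (ξ - η) * U (ξ - η) * V η + U (ξ - η) * (s η * V η)) := by
        refine mul_le_mul_right (lintegral_mono fun η => ?_) k
        calc s ξ * (U (ξ - η) * V η) ≤ c * (s (ξ - η) + s η) * (U (ξ - η) * V η) := by
              gcongr; exact hsub ξ η
          _ = _ := by ring
      _ = k * c * (F ξ + G ξ) := by
        rw [lintegral_const_mul _ (by fun_prop), lintegral_add_left (by fun_prop), ← hGξ,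
          mul_assoc]
  have hadd : ∀ a b : ℝ≥0∞, (a + b) ^ 2 ≤ 2 * (a ^ 2 + b ^ 2) := fun a b => by
    have := ENNReal.rpow_add_le_mul_rpow_add_rpow a b (p := 2) one_le_two
    norm_num at this
    exact this
  calc ∫⁻ ξ, (s ξ * w ξ) ^ 2 ≤ ∫⁻ ξ, 2 * (k * c) ^ 2 * (F ξ ^ 2 + G ξ ^ 2) := by
        refine lintegral_mono fun ξ => ?_
        calc (s ξ * w ξ) ^ 2 ≤ (k * c * (F ξ + G ξ)) ^ 2 :=
            pow_le_pow_left₀ bot_le (hpt ξ) 2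
          _ = (k * c) ^ 2 * (F ξ + G ξ) ^ 2 := mul_pow _ _ _
          _ ≤ (k * c) ^ 2 * (2 * (F ξ ^ 2 + G ξ ^ 2)) := by gcongr; exact hadd _ _
          _ = _ := by ring
    _ = 2 * (k * c) ^ 2 * ((∫⁻ ξ, F ξ ^ 2) + ∫⁻ ξ, G ξ ^ 2) := by
        rw [lintegral_const_mul _ (by fun_prop), lintegral_add_left (by fun_prop)]
    _ ≤ _ := by
        gcongr
        · exact lintegral_convolution_sq_le (f := fun ξ => s ξ * U ξ) (by fun_prop) hV
        · exact lintegral_convolution_sq_le (f := fun ξ => s ξ * V ξ) (by fun_prop) hU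

/-- If `√γ` is subadditive up to the constant `C`, then there is a constant `C'` depending only
on `C` such that `|uv|_γ ≤ C' (|u|_γ ‖v̂‖_{L¹} + |v|_γ ‖û‖_{L¹})` for all Schwartz `u, v`. -/
theorem stmt_3 (C : ℝ) (hC : 0 < C) :
    ∃ C' : ℝ, 0 < C' ∧
      ∀ γ : ℝ → ℝ, Measurable γ → (∀ ξ : ℝ, 0 < γ ξ) →
        (∀ ξ η : ℝ, Real.sqrt (γ ξ) ≤ C * (Real.sqrt (γ (ξ - η)) + Real.sqrt (γ η))) →
        ∀ u v : SchwartzMap ℝ ℂ,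
          Real.sqrt (∫ ξ : ℝ, γ ξ * ‖FT (fun x => u x * v x) ξ‖ ^ 2) ≤
            C' * (Real.sqrt (∫ ξ : ℝ, γ ξ * ‖FT (⇑u) ξ‖ ^ 2) * (∫ ξ : ℝ, ‖FT (⇑v) ξ‖) +
              Real.sqrt (∫ ξ : ℝ, γ ξ * ‖FT (⇑v) ξ‖ ^ 2) * (∫ ξ : ℝ, ‖FT (⇑u) ξ‖)) := by
  refine ⟨C, hC, fun γ hγ hγ0 hsub u v => ?_⟩
  obtain ⟨K, p, hK, hbound⟩ := exists_le_mul_one_add_abs_pow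
    (g := fun ξ => Real.sqrt (γ ξ)) hγ.sqrt (fun ξ => Real.sqrt_pos.mpr (hγ0 ξ)) hC hsub
  have hsq : ∀ (z : ℂ) (ξ : ℝ), ENNReal.ofReal (γ ξ * ‖z‖ ^ 2) =
      (ENNReal.ofReal (Real.sqrt (γ ξ)) * ‖z‖ₑ) ^ 2 := fun z ξ => by
    rw [← ofReal_norm, ← ENNReal.ofReal_mul (Real.sqrt_nonneg _),
      ← ENNReal.ofReal_pow (by positivity), mul_pow, Real.sq_sqrt (hγ0 ξ).le]
  have hnn : ∀ w : ℝ → ℂ, 0 ≤ᵐ[volume] fun ξ => γ ξ * ‖FT w ξ‖ ^ 2 := fun w =>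
    Filter.Eventually.of_forall fun ξ => mul_nonneg (hγ0 ξ).le (by positivity)
  have hL2 : ∀ w : SchwartzMap ℝ ℂ, ENNReal.ofReal (∫ ξ, γ ξ * ‖FT w ξ‖ ^ 2) =
      ∫⁻ ξ, (ENNReal.ofReal (Real.sqrt (γ ξ)) * ‖FT w ξ‖ₑ) ^ 2 := fun w => by
    rw [ofReal_integral_eq_lintegral_ofReal
      (integrable_mul_norm_FT_sq hγ hγ0 hK hbound w) (hnn w)]
    simp only [hsq]
  have hL1 := fun w : SchwartzMap ℝ ℂ => ofReal_integral_norm_eq_lintegral_enorm (integrable_FT w)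
  have hmeas := fun w : SchwartzMap ℝ ℂ => (continuous_FT w).measurable.enorm
  have hnonneg : ∀ w : ℝ → ℂ, 0 ≤ ∫ ξ, γ ξ * ‖FT w ξ‖ ^ 2 := fun w =>
    integral_nonneg_of_ae (hnn w)
  have hnonneg' : ∀ w : ℝ → ℂ, 0 ≤ ∫ ξ, ‖FT w ξ‖ := fun w =>
    integral_nonneg fun ξ => norm_nonneg _
  have hmain := lintegral_weight_mul_sq_le
    (s := fun ξ => ENNReal.ofReal (Real.sqrt (γ ξ))) (U := fun ξ => ‖FT u ξ‖ₑ)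
    (V := fun ξ => ‖FT v ξ‖ₑ) (w := fun ξ => ‖FT (fun x => u x * v x) ξ‖ₑ)
    (c := ENNReal.ofReal C) (k := ENNReal.ofReal (2 * Real.pi)⁻¹)
    hγ.sqrt.ennreal_ofReal (hmeas u) (hmeas v)
    (fun ξ η => by
      rw [← ENNReal.ofReal_add (Real.sqrt_nonneg _) (Real.sqrt_nonneg _),
        ← ENNReal.ofReal_mul hC.le]
      exact ENNReal.ofReal_le_ofReal (hsub ξ η))
    (fun ξ => by
      simp only [FT_mul, enorm_mul]
      gcongr
      · rw [← ofReal_norm]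
        refine ENNReal.ofReal_le_ofReal (le_of_eq ?_)
        rw [Complex.norm_real, Real.norm_of_nonneg (by positivity)]
      · refine (enorm_integral_le_lintegral_enorm _).trans (le_of_eq ?_)
        simp only [enorm_mul])
  set A := ∫ ξ, γ ξ * ‖FT u ξ‖ ^ 2 with hA
  set D := ∫ ξ, γ ξ * ‖FT v ξ‖ ^ 2 with hD
  set a := ∫ ξ, ‖FT u ξ‖ with ha
  set d := ∫ ξ, ‖FT v ξ‖ with hd
  have hA0 : 0 ≤ A := hnonneg u
  have hD0 : 0 ≤ D := hnonneg v
  have ha0 : 0 ≤ a := hnonneg' u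
  have hd0 : 0 ≤ d := hnonneg' v
  have hpi : 0 < (2 * Real.pi)⁻¹ := by positivity
  have hpi1 : (2 * Real.pi)⁻¹ ≤ 1 / 2 := by
    rw [inv_le_comm₀ (by positivity) (by norm_num)]
    linarith [Real.pi_gt_three]
  have hfin : ∫ ξ, γ ξ * ‖FT (fun x => u x * v x) ξ‖ ^ 2 ≤
      2 * ((2 * Real.pi)⁻¹ * C) ^ 2 * (A * d ^ 2 + D * a ^ 2) := by
    refine (Real.le_norm_self _).trans ((norm_integral_le_lintegral_norm _).trans ?_)
    refine ENNReal.toReal_le_of_le_ofReal (by positivity) ?_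
    simp only [Real.norm_of_nonneg (mul_nonneg (hγ0 _).le (sq_nonneg _)), hsq]
    refine hmain.trans (le_of_eq ?_)
    rw [← hL2 u, ← hL2 v, ← hL1 u, ← hL1 v, ENNReal.ofReal_mul (by positivity),
      ENNReal.ofReal_mul zero_le_two, ENNReal.ofReal_pow (by positivity),
      ENNReal.ofReal_mul hpi.le, ENNReal.ofReal_add (by positivity) (by positivity),
      ENNReal.ofReal_mul hA0, ENNReal.ofReal_mul hD0, ENNReal.ofReal_pow hd0,
      ENNReal.ofReal_pow ha0, ENNReal.ofReal_ofNat]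
  refine Real.sqrt_le_iff.mpr ⟨by positivity, hfin.trans ?_⟩
  calc 2 * ((2 * Real.pi)⁻¹ * C) ^ 2 * (A * d ^ 2 + D * a ^ 2)
      ≤ 2 * (1 / 2 * C) ^ 2 * (A * d ^ 2 + D * a ^ 2) := by gcongr
    _ ≤ C ^ 2 * (A * d ^ 2 + D * a ^ 2) := by
      gcongr
      nlinarith [sq_nonneg C]
    _ = C ^ 2 * ((Real.sqrt A * d) ^ 2 + (Real.sqrt D * a) ^ 2) := by
      rw [mul_pow, mul_pow, Real.sq_sqrt hA0, Real.sq_sqrt hD0]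
    _ ≤ C ^ 2 * (Real.sqrt A * d + Real.sqrt D * a) ^ 2 := by
      gcongr
      have : 0 ≤ (Real.sqrt A * d) * (Real.sqrt D * a) := by positivity
      nlinarith
    _ = _ := (mul_pow _ _ _).symm
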